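/- Let M₁,…,M_{ℓ+1} be natural numbers and let E be a finite set of pairs (k, x) where 1 ≤ k ≤ ℓ and x = (i_{k+1},…,i_{ℓ+1}) satisfies 0 ≤ i_r ≤ M_r for k+1 ≤ r ≤ ℓ and |i_{ℓ+1}| ≤ M_{ℓ+1}; write B_{k,x} = {γ ∈ Γ : γ(k) > M_k and γ(r) = i_r for all k+1 ≤ r ≤ ℓ+1} and A₁ = {γ ∈ Γ : γ(ℓ+1) > M_{ℓ+1}}. Let Γ⁺ = A₁ ∪ ⋃_{(k,x)∈E} B_{k,x}, let P be the orthogonal projection of H onto the closed span of {e_γ : γ ∈ Γ⁺}, and let U be the unitary with U e_γ = e_{γ+ε_{ℓ+1}} if γ(1)=…=γ(ℓ)=0 and U e_γ = e_γ otherwise. Then the compression T : ran P → ran P, T x = P(U x), is injective, has closed range, and the orthogonal complement of its range inside ran P is spanned by e_{(0,…,0,M_{ℓ+1}+1)}. In particular T is Fredholm of index −1. -/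

import Mathlib

open scoped BigOperators InnerProductSpace

noncomputable section

/-- The index set `Γ = ℕ^ℓ × ℤ`. -/
abbrev Gamma (ℓ : ℕ) : Type := (Fin ℓ → ℕ) × ℤ

/-- The Hilbert space `H = ℓ²(Γ)`. -/
abbrev Hsp (ℓ : ℕ) := lp (fun _ : Gamma ℓ => ℂ) 2

/-- The standard orthonormal basis vector `e_γ`. -/
def e (ℓ : ℕ) (γ : Gamma ℓ) : Hsp ℓ := lp.single 2 γ 1

/-- `ε_k ∈ Γ`: the element whose `k`-th coordinate is `1` and all other coordinates are `0`
(`k` is zero-indexed: `k : Fin (ℓ+1)` corresponds to the coordinate `k+1` of the paper). -/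
def eps (ℓ : ℕ) (k : Fin (ℓ+1)) : Gamma ℓ :=
  if h : (k : ℕ) < ℓ then (Pi.single ⟨(k : ℕ), h⟩ 1, 0) else (0, 1)

/-- The `k`-th coordinate of `γ ∈ Γ`, viewed in `ℤ` (zero-indexed). -/
def coord {ℓ : ℕ} (γ : Gamma ℓ) (k : Fin (ℓ+1)) : ℤ :=
  if h : (k : ℕ) < ℓ then (γ.1 ⟨(k : ℕ), h⟩ : ℤ) else γ.2

/-- `γ(1) + … + γ(k−1)` (sum of the coordinates strictly before position `k`). -/
def sumBelow {ℓ : ℕ} (k : Fin (ℓ+1)) (γ : Gamma ℓ) : ℕ :=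
  ∑ j ∈ Finset.univ.filter (fun j : Fin ℓ => (j : ℕ) < (k : ℕ)), γ.1 j

/-- The growth condition `|d(γ+ε_k) − d(γ)| ≤ c·q^{−(γ(1)+…+γ(k−1))}` for all `γ` and `k`. -/
def GrowthCondition (ℓ : ℕ) (q c : ℝ) (d : Gamma ℓ → ℝ) : Prop :=
  ∀ (k : Fin (ℓ+1)) (γ : Gamma ℓ),
    |d (γ + eps ℓ k) - d γ| ≤ c * (q ^ sumBelow k γ)⁻¹

/-- The set `B_{k,x} = {γ : γ(k) > M_k, γ(r) = x_r for r > k}` (zero-indexed `k`). -/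
def Bset (ℓ : ℕ) (M : Fin (ℓ+1) → ℕ) (k : Fin ℓ) (x : Fin (ℓ+1) → ℤ) : Set (Gamma ℓ) :=
  {γ : Gamma ℓ | (M k.castSucc : ℤ) < (γ.1 k : ℤ) ∧
    ∀ r : Fin (ℓ+1), (k : ℕ) < (r : ℕ) → coord γ r = x r}

/-- `A₁ = {γ : γ(ℓ+1) > M_{ℓ+1}}`. -/
def A1set (ℓ : ℕ) (M : Fin (ℓ+1) → ℕ) : Set (Gamma ℓ) :=
  {γ : Gamma ℓ | (M (Fin.last ℓ) : ℤ) < γ.2}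

/-- `A₂ = {γ : γ(ℓ+1) < −M_{ℓ+1}}`. -/
def A2set (ℓ : ℕ) (M : Fin (ℓ+1) → ℕ) : Set (Gamma ℓ) :=
  {γ : Gamma ℓ | γ.2 < -(M (Fin.last ℓ) : ℤ)}

/-- The admissibility condition on the finite index set `E`:
each `(k, x) ∈ E` satisfies `0 ≤ x_r ≤ M_r` for `k < r ≤ ℓ` and `|x_{ℓ+1}| ≤ M_{ℓ+1}`. -/
def Eadm (ℓ : ℕ) (M : Fin (ℓ+1) → ℕ) (E : Finset (Fin ℓ × (Fin (ℓ+1) → ℤ))) : Prop :=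
  ∀ p ∈ E, (∀ r : Fin ℓ, (p.1 : ℕ) < (r : ℕ) →
      0 ≤ p.2 r.castSucc ∧ p.2 r.castSucc ≤ (M r.castSucc : ℤ)) ∧
    |p.2 (Fin.last ℓ)| ≤ (M (Fin.last ℓ) : ℤ)

lemma e_apply {ℓ : ℕ} (γ δ : Gamma ℓ) : (e ℓ γ) δ = if δ = γ then 1 else 0 := by
  simp [e, lp.single_apply, Pi.single_apply]

lemma inner_e_left {ℓ : ℕ} (γ : Gamma ℓ) (y : Hsp ℓ) : ⟪e ℓ γ, y⟫_ℂ = y γ := by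
  simp [e, lp.inner_single_left]

lemma map_apply_eq_apply_of_basis {ℓ : ℕ} (T : Hsp ℓ →L[ℂ] Hsp ℓ) (γ δ : Gamma ℓ)
    (h : ∀ α, (T (e ℓ α)) γ = (e ℓ α) δ) (x : Hsp ℓ) : (T x) γ = x δ := by
  have key : (innerSL ℂ (e ℓ γ)).comp T = innerSL ℂ (e ℓ δ) := by
    refine lp.ext_continuousLinearMap (p := 2) (by norm_num) fun α => ?_
    ext
    change ⟪e ℓ γ, T (e ℓ α)⟫_ℂ = ⟪e ℓ δ, e ℓ α⟫_ℂ
    rw [inner_e_left, inner_e_left, h]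
  simpa [inner_e_left] using DFunLike.congr_fun key x

lemma map_apply_eq_zero_of_basis {ℓ : ℕ} (T : Hsp ℓ →L[ℂ] Hsp ℓ) (γ : Gamma ℓ)
    (h : ∀ α, (T (e ℓ α)) γ = 0) (x : Hsp ℓ) : (T x) γ = 0 := by
  have key : (innerSL ℂ (e ℓ γ)).comp T = 0 := by
    refine lp.ext_continuousLinearMap (p := 2) (by norm_num) fun α => ?_
    ext
    change ⟪e ℓ γ, T (e ℓ α)⟫_ℂ = 0
    rw [inner_e_left, h]
  simpa [inner_e_left] using DFunLike.congr_fun key x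

lemma eps_last (ℓ : ℕ) : eps ℓ (Fin.last ℓ) = (0, 1) := by
  simp [eps]

lemma not_mem_Bset_of_fst_eq_zero {ℓ : ℕ} (M : Fin (ℓ+1) → ℕ) (k : Fin ℓ)
    (x : Fin (ℓ+1) → ℤ) {γ : Gamma ℓ} (h : γ.1 = 0) : γ ∉ Bset ℓ M k x := by
  rintro ⟨h1, -⟩
  simp only [h, Pi.zero_apply, Nat.cast_zero] at h1
  omega

lemma mem_union_Bset_iff_of_fst_eq_zero {ℓ : ℕ} (M : Fin (ℓ+1) → ℕ)
    (E : Finset (Fin ℓ × (Fin (ℓ+1) → ℤ))) {γ : Gamma ℓ} (h : γ.1 = 0) :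
    γ ∈ A1set ℓ M ∪ ⋃ p ∈ E, Bset ℓ M p.1 p.2 ↔ (M (Fin.last ℓ) : ℤ) < γ.2 := by
  simp [not_mem_Bset_of_fst_eq_zero M _ _ h, A1set]

/-- for `Γ⁺ = A₁ ∪ ⋃_{(k,x)∈E} B_{k,x}`, the compression `T = PUP` of the
unitary `U` to `ran P` is injective, has closed range, and the orthogonal complement of
its range inside `ran P` is the span of `e_{(0,…,0,M_{ℓ+1}+1)}`; in particular `T` is
Fredholm of index `−1`. -/
theorem stmt10 (ℓ : ℕ) (hℓ : 1 ≤ ℓ) (M : Fin (ℓ+1) → ℕ)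
    (E : Finset (Fin ℓ × (Fin (ℓ+1) → ℤ))) (hE : Eadm ℓ M E)
    (U P : Hsp ℓ →L[ℂ] Hsp ℓ)
    (hU1 : ∀ γ : Gamma ℓ, γ.1 = 0 → U (e ℓ γ) = e ℓ (γ + eps ℓ (Fin.last ℓ)))
    (hU2 : ∀ γ : Gamma ℓ, γ.1 ≠ 0 → U (e ℓ γ) = e ℓ γ)
    (hP1 : ∀ γ ∈ A1set ℓ M ∪ ⋃ p ∈ E, Bset ℓ M p.1 p.2, P (e ℓ γ) = e ℓ γ)
    (hP2 : ∀ γ ∉ A1set ℓ M ∪ ⋃ p ∈ E, Bset ℓ M p.1 p.2, P (e ℓ γ) = 0) :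
    (∀ x : Hsp ℓ, P x = x → P (U x) = 0 → x = 0) ∧
    IsClosed {y : Hsp ℓ | ∃ x : Hsp ℓ, P x = x ∧ y = P (U x)} ∧
    (∀ y : Hsp ℓ, P y = y →
      ((∀ x : Hsp ℓ, P x = x → ⟪P (U x), y⟫_ℂ = 0) ↔
        ∃ c : ℂ, y = c • e ℓ (0, (M (Fin.last ℓ) : ℤ) + 1))) := by
  have hmem := fun (γ : Gamma ℓ) (h : γ.1 = 0) => mem_union_Bset_iff_of_fst_eq_zero M E h
  generalize A1set ℓ M ∪ ⋃ p ∈ E, Bset ℓ M p.1 p.2 = S at hP1 hP2 hmem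
  set m : ℤ := (M (Fin.last ℓ) : ℤ)
  have P_in : ∀ x : Hsp ℓ, ∀ γ ∈ S, (P x) γ = x γ := by
    intro x γ hγ
    refine map_apply_eq_apply_of_basis P γ γ (fun α => ?_) x
    by_cases hα : α ∈ S
    · rw [hP1 α hα]
    · have : γ ≠ α := fun h => hα (h ▸ hγ)
      simp [hP2 α hα, e_apply, this]
  have P_out : ∀ x : Hsp ℓ, ∀ γ ∉ S, (P x) γ = 0 := by
    intro x γ hγ
    refine map_apply_eq_zero_of_basis P γ (fun α => ?_) x
    by_cases hα : α ∈ S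
    · have : γ ≠ α := fun h => hγ (h ▸ hα)
      simp [hP1 α hα, e_apply, this]
    · simp [hP2 α hα]
  have P_fix : ∀ x : Hsp ℓ, P x = x ↔ ∀ γ ∉ S, x γ = 0 := by
    refine fun x => ⟨fun h γ hγ => h ▸ P_out x γ hγ, fun h => ?_⟩
    ext γ
    by_cases hγ : γ ∈ S
    · exact P_in x γ hγ
    · rw [P_out x γ hγ, h γ hγ]
  have U_ne : ∀ x : Hsp ℓ, ∀ γ : Gamma ℓ, γ.1 ≠ 0 → (U x) γ = x γ := by
    intro x γ hγ
    refine map_apply_eq_apply_of_basis U γ γ (fun α => ?_) x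
    by_cases hα : α.1 = 0
    · have h1 : γ ≠ α := fun h => hγ (h ▸ hα)
      have h2 : γ ≠ α + eps ℓ (Fin.last ℓ) := by
        rintro rfl
        exact hγ (by simp [eps_last, hα])
      simp [hU1 α hα, e_apply, h1, h2]
    · rw [hU2 α hα]
  have U_zero : ∀ x : Hsp ℓ, ∀ n : ℤ, (U x) (0, n + 1) = x (0, n) := by
    intro x n
    refine map_apply_eq_apply_of_basis U (0, n + 1) (0, n) (fun α => ?_) x
    by_cases hα : α.1 = 0
    · simp [hU1 α hα, e_apply, eps_last, Prod.ext_iff]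
    · rw [hU2 α hα]
      simp [e_apply, Prod.ext_iff, Ne.symm hα]
  have pair_of_fst : ∀ γ : Gamma ℓ, γ.1 = 0 → ∃ n : ℤ, γ = (0, n + 1) :=
    fun γ h => ⟨γ.2 - 1, by ext <;> simp [h]⟩
  have range_zero : ∀ x : Hsp ℓ, P x = x → (P (U x)) (0, m + 1) = 0 := by
    intro x hx
    rw [P_in _ _ ((hmem _ rfl).2 (lt_add_one m)), U_zero]
    exact (P_fix x).1 hx _ fun h => lt_irrefl m ((hmem _ rfl).1 h)
  refine ⟨fun x hx h0 => ?_, ?_, fun y hy => ⟨fun h => ⟨y (0, m + 1), ?_⟩, ?_⟩⟩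
  · ext γ
    rw [lp.coeFn_zero, Pi.zero_apply]
    by_cases hγ : γ ∈ S
    · by_cases h1 : γ.1 = 0
      · obtain ⟨n, rfl⟩ := pair_of_fst γ h1
        have hn := (hmem _ rfl).1 hγ
        rw [← U_zero x, ← P_in (U x) _ ((hmem _ rfl).2 (hn.trans (lt_add_one _))), h0,
          lp.coeFn_zero, Pi.zero_apply]
      · rw [← U_ne x γ h1, ← P_in _ γ hγ, h0, lp.coeFn_zero, Pi.zero_apply]
    · exact (P_fix x).1 hx γ hγ
  · have hrange : {y : Hsp ℓ | ∃ x : Hsp ℓ, P x = x ∧ y = P (U x)} =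
        {y | P y = y} ∩ {y | ⟪e ℓ (0, m + 1), y⟫_ℂ = 0} := by
      ext y
      simp only [Set.mem_ofPred_eq, Set.mem_inter_iff, inner_e_left]
      constructor
      · rintro ⟨x, hx, rfl⟩
        exact ⟨(P_fix _).2 (P_out _), range_zero x hx⟩
      · rintro ⟨hy, hy0⟩
        have adj_ne : ∀ γ : Gamma ℓ, γ.1 ≠ 0 → (U.adjoint y) γ = y γ := fun γ hγ => by
          rw [← inner_e_left, ContinuousLinearMap.adjoint_inner_right, hU2 γ hγ, inner_e_left]
        have adj_zero : ∀ n : ℤ, (U.adjoint y) (0, n) = y (0, n + 1) := fun n => by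
          rw [← inner_e_left, ContinuousLinearMap.adjoint_inner_right, hU1 _ rfl, inner_e_left,
            eps_last, Prod.mk_add_mk, add_zero]
        refine ⟨U.adjoint y, (P_fix _).2 fun γ hγ => ?_, ?_⟩
        · by_cases h1 : γ.1 = 0
          · obtain ⟨n, rfl⟩ := pair_of_fst γ h1
            rw [adj_zero]
            by_cases hn : n + 1 = m
            · rw [hn, hy0]
            · refine (P_fix y).1 hy _ fun h => hγ ((hmem _ rfl).2 ?_)
              have := (hmem _ rfl).1 h
              simp only at this ⊢
              omega
          · rw [adj_ne γ h1, (P_fix y).1 hy γ hγ]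
        · ext γ
          by_cases hγ : γ ∈ S
          · rw [P_in _ γ hγ]
            by_cases h1 : γ.1 = 0
            · obtain ⟨n, rfl⟩ := pair_of_fst γ h1
              rw [U_zero, adj_zero]
            · rw [U_ne _ γ h1, adj_ne γ h1]
          · rw [P_out _ γ hγ, (P_fix y).1 hy γ hγ]
    rw [hrange]
    exact (isClosed_eq P.continuous continuous_id).inter
      (isClosed_eq (innerSL ℂ (e ℓ (0, m + 1))).continuous continuous_const)
  · ext γ
    rw [lp.coeFn_smul, Pi.smul_apply, e_apply]
    by_cases hγ : γ = (0, m + 1)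
    · simp [hγ]
    rw [if_neg hγ, smul_zero]
    by_cases hS : γ ∈ S
    · by_cases h1 : γ.1 = 0
      · obtain ⟨n, rfl⟩ := pair_of_fst γ h1
        have hn := (hmem _ rfl).1 hS
        have hne : n ≠ m := by rintro rfl; exact hγ rfl
        have hn' : ((0, n) : Gamma ℓ) ∈ S := (hmem _ rfl).2 (by simp only at hn ⊢; omega)
        have := h (e ℓ (0, n)) (hP1 _ hn')
        rwa [hU1 _ rfl, eps_last, Prod.mk_add_mk, add_zero, hP1 _ hS, inner_e_left] at this
      · have := h (e ℓ γ) (hP1 γ hS)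
        rwa [hU2 γ h1, hP1 γ hS, inner_e_left] at this
    · exact (P_fix y).1 hy γ hS
  · rintro ⟨c, rfl⟩ x hx
    rw [inner_smul_right, ← inner_conj_symm, inner_e_left, range_zero x hx, map_zero, mul_zero]
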